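/- Let n ≥ 2, r > 0, and let f be a C² real-valued function on the closed ball B̄_r ⊂ ℝⁿ. Then inf_{x∈B̄_r} |R(x)| ≤ (sup_{x∈B̄_r} |H(x)| + 1/r)·(2/r). -/

import Mathlib

open Metric Finset

/-- Coordinates of the gradient of `f` at `x`. -/
noncomputable def grad (n : ℕ) (f : EuclideanSpace ℝ (Fin n) → ℝ)
    (x : EuclideanSpace ℝ (Fin n)) : Fin n → ℝ :=
  fun i => fderiv ℝ f x (EuclideanSpace.single i 1)

/-- The Hessian matrix `D²f(x)`. -/
noncomputable def hess (n : ℕ) (f : EuclideanSpace ℝ (Fin n) → ℝ)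
    (x : EuclideanSpace ℝ (Fin n)) : Matrix (Fin n) (Fin n) ℝ :=
  Matrix.of fun i j =>
    fderiv ℝ (fun y => fderiv ℝ f y (EuclideanSpace.single j 1)) x (EuclideanSpace.single i 1)

/-- `|∇f(x)|²`. -/
noncomputable def gradSq (n : ℕ) (f : EuclideanSpace ℝ (Fin n) → ℝ)
    (x : EuclideanSpace ℝ (Fin n)) : ℝ :=
  ∑ i, grad n f x i ^ 2

/-- The shape operator of the graph of `f`, with respect to the upward unit normal:
`W(x) = (1+|∇f|²)^{-1/2} (Iₙ - ∇f ∇fᵀ/(1+|∇f|²)) D²f(x)`. -/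
noncomputable def shapeOp (n : ℕ) (f : EuclideanSpace ℝ (Fin n) → ℝ)
    (x : EuclideanSpace ℝ (Fin n)) : Matrix (Fin n) (Fin n) ℝ :=
  (Real.sqrt (1 + gradSq n f x))⁻¹ •
    (((1 : Matrix (Fin n) (Fin n) ℝ) -
      Matrix.of fun i j => grad n f x i * grad n f x j / (1 + gradSq n f x)) * hess n f x)

/-- The mean curvature `H(x) = tr W(x) / n`. -/
noncomputable def meanCurv (n : ℕ) (f : EuclideanSpace ℝ (Fin n) → ℝ)
    (x : EuclideanSpace ℝ (Fin n)) : ℝ :=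
  (shapeOp n f x).trace / n

/-- The scalar curvature `R(x) = ((tr W)² - tr(W²)) / (n(n-1))`. -/
noncomputable def scalarCurv (n : ℕ) (f : EuclideanSpace ℝ (Fin n) → ℝ)
    (x : EuclideanSpace ℝ (Fin n)) : ℝ :=
  ((shapeOp n f x).trace ^ 2 - (shapeOp n f x * shapeOp n f x).trace) /
    ((n : ℝ) * ((n : ℝ) - 1))

/-- The length `|A|(x) = √(tr(W(x)²))` of the second fundamental form. -/
noncomputable def normA (n : ℕ) (f : EuclideanSpace ℝ (Fin n) → ℝ)
    (x : EuclideanSpace ℝ (Fin n)) : ℝ :=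
  Real.sqrt ((shapeOp n f x * shapeOp n f x).trace)

section MatrixTrace

open Matrix

variable {ι : Type*} [Fintype ι]

open scoped MatrixOrder in
lemma Matrix.PosSemidef.exists_eq_transpose_mul_self {P : Matrix ι ι ℝ} (hP : P.PosSemidef) :
    ∃ B : Matrix ι ι ℝ, P = Bᵀ * B := by
  classical
  obtain ⟨B, hB⟩ := CStarAlgebra.nonneg_iff_eq_star_mul_self.mp hP.nonneg
  exact ⟨B, by simpa [star_eq_conjTranspose] using hB⟩

lemma trace_conj_eq (B D : Matrix ι ι ℝ) : (Bᵀ * B * D).trace = (B * D * Bᵀ).trace := by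
  rw [Matrix.mul_assoc, Matrix.trace_mul_comm]

lemma trace_conj_mul_conj_eq (B D : Matrix ι ι ℝ) :
    (Bᵀ * B * D * (Bᵀ * B * D)).trace = (B * D * Bᵀ * (B * D * Bᵀ)).trace := by
  rw [show Bᵀ * B * D * (Bᵀ * B * D) = Bᵀ * (B * D * Bᵀ * B * D) by simp only [Matrix.mul_assoc],
    Matrix.trace_mul_comm]
  simp only [Matrix.mul_assoc]

lemma Matrix.IsSymm.trace_mul_self {N : Matrix ι ι ℝ} (hN : N.IsSymm) :
    (N * N).trace = ∑ i, ∑ j, N i j ^ 2 := by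
  simp only [trace, diag_apply, mul_apply]
  refine Finset.sum_congr rfl fun i _ => Finset.sum_congr rfl fun j _ => ?_
  rw [hN.apply i j, sq]

lemma Matrix.IsSymm.sq_trace_le {N : Matrix ι ι ℝ} (hN : N.IsSymm) :
    N.trace ^ 2 ≤ Fintype.card ι * (N * N).trace := by
  rw [hN.trace_mul_self]
  refine (sq_sum_le_card_mul_sum_sq (s := Finset.univ) (f := fun i => N i i)).trans ?_
  rw [Finset.card_univ]
  gcongr with i _
  exact Finset.single_le_sum (f := fun j => N i j ^ 2) (fun j _ => sq_nonneg _)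
    (Finset.mem_univ i)

lemma Matrix.PosSemidef.trace_mul_self_le {N : Matrix ι ι ℝ} (hN : N.PosSemidef) :
    (N * N).trace ≤ N.trace ^ 2 := by
  have hsymm : N.IsSymm := by simpa [Matrix.IsHermitian, Matrix.IsSymm] using hN.isHermitian
  obtain ⟨C, rfl⟩ := hN.exists_eq_transpose_mul_self
  rw [hsymm.trace_mul_self, sq, trace, Finset.sum_mul_sum]
  gcongr with i _ j _
  simp only [diag_apply, mul_apply, transpose_apply, ← sq]
  exact Finset.sum_mul_sq_le_sq_mul_sq _ _ _

/-- The trace of a product of a positive semidefinite and a symmetric matrix satisfies the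
Cauchy–Schwarz inequality. -/
lemma Matrix.PosSemidef.sq_trace_mul_le {P D : Matrix ι ι ℝ} (hP : P.PosSemidef)
    (hD : D.IsSymm) : (P * D).trace ^ 2 ≤ Fintype.card ι * (P * D * (P * D)).trace := by
  obtain ⟨B, rfl⟩ := hP.exists_eq_transpose_mul_self
  rw [trace_conj_eq, trace_conj_mul_conj_eq]
  refine Matrix.IsSymm.sq_trace_le ?_
  simp [Matrix.IsSymm, transpose_mul, hD.eq, Matrix.mul_assoc]

lemma Matrix.PosSemidef.trace_mul_nonneg_and_trace_sq_le {P E : Matrix ι ι ℝ}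
    (hP : P.PosSemidef) (hE : E.PosSemidef) :
    0 ≤ (P * E).trace ∧ (P * E * (P * E)).trace ≤ (P * E).trace ^ 2 := by
  obtain ⟨B, rfl⟩ := hP.exists_eq_transpose_mul_self
  rw [trace_conj_eq, trace_conj_mul_conj_eq]
  have h : (B * E * Bᵀ).PosSemidef := by simpa using hE.mul_mul_conjTranspose_same B
  exact ⟨h.trace_nonneg, h.trace_mul_self_le⟩

end MatrixTrace

section ShapeOperator

open Matrix

variable {n : ℕ} {f : EuclideanSpace ℝ (Fin n) → ℝ}

/-- The inverse of the metric induced on a graph whose gradient is `g`. -/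
noncomputable def invMetric (g : Fin n → ℝ) : Matrix (Fin n) (Fin n) ℝ :=
  1 - Matrix.of fun i j => g i * g j / (1 + ∑ k, g k ^ 2)

lemma invMetric_eq (g : Fin n → ℝ) :
    invMetric g = 1 - (1 + g ⬝ᵥ g)⁻¹ • vecMulVec g g := by
  ext i j
  simp [invMetric, vecMulVec_apply, dotProduct, sq]
  ring

lemma dotProduct_vecMulVec_mulVec (g u : Fin n → ℝ) :
    u ⬝ᵥ (vecMulVec g g *ᵥ u) = (g ⬝ᵥ u) ^ 2 := by
  rw [vecMulVec_mulVec, dotProduct_comm u]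
  simp [sq, dotProduct_comm g u]

lemma vecMulVec_self_isSymm (g : Fin n → ℝ) : (vecMulVec g g).IsSymm := by
  simp [Matrix.IsSymm, transpose_vecMulVec]

lemma posSemidef_of_isSymm {M : Matrix (Fin n) (Fin n) ℝ} (h : M.IsSymm)
    (h' : ∀ u, 0 ≤ u ⬝ᵥ (M *ᵥ u)) : M.PosSemidef :=
  .of_dotProduct_mulVec_nonneg (by simpa [Matrix.IsHermitian, Matrix.IsSymm] using h)
    (by simpa using h')

lemma invMetric_posSemidef (g : Fin n → ℝ) : (invMetric g).PosSemidef := by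
  rw [invMetric_eq]
  have hg : 0 ≤ g ⬝ᵥ g := by simpa using dotProduct_star_self_nonneg g
  refine posSemidef_of_isSymm
    (isSymm_one.sub ((vecMulVec_self_isSymm g).smul _)) fun u => ?_
  have hu : 0 ≤ u ⬝ᵥ u := by simpa using dotProduct_star_self_nonneg u
  have hcs : (g ⬝ᵥ u) ^ 2 ≤ (g ⬝ᵥ g) * (u ⬝ᵥ u) := by
    simpa [dotProduct, sq] using Finset.sum_mul_sq_le_sq_mul_sq Finset.univ g u
  rw [sub_mulVec, one_mulVec, smul_mulVec, dotProduct_sub, dotProduct_smul,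
    dotProduct_vecMulVec_mulVec, smul_eq_mul, sub_nonneg, inv_mul_le_iff₀ (by positivity)]
  nlinarith

lemma invMetric_mul_metric (g : Fin n → ℝ) : invMetric g * (1 + vecMulVec g g) = 1 := by
  have hg : 0 ≤ g ⬝ᵥ g := by simpa using dotProduct_star_self_nonneg g
  have h : (1 + g ⬝ᵥ g) ≠ 0 := by positivity
  rw [invMetric_eq]
  have hv : vecMulVec g g * vecMulVec g g = (g ⬝ᵥ g) • vecMulVec g g := by
    simp [vecMulVec_mul_vecMulVec]
  rw [mul_add, sub_mul, sub_mul, smul_mul_assoc, smul_mul_assoc, hv, mul_one, one_mul, mul_one]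
  ext i j
  simp
  field_simp
  ring

lemma shapeOp_eq (x : EuclideanSpace ℝ (Fin n)) :
    shapeOp n f x =
      invMetric (grad n f x) * ((Real.sqrt (1 + gradSq n f x))⁻¹ • hess n f x) := by
  rw [mul_smul_comm]; rfl

lemma hess_apply (hf : ContDiff ℝ 2 f) (x : EuclideanSpace ℝ (Fin n)) (i j : Fin n) :
    hess n f x i j =
      fderiv ℝ (fderiv ℝ f) x (EuclideanSpace.single i 1) (EuclideanSpace.single j 1) := by
  have hd : DifferentiableAt ℝ (fderiv ℝ f) x :=
    ((hf.fderiv_right (m := 1) (by norm_num)).differentiable (by norm_num)) x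
  simp only [hess, of_apply]
  rw [fderiv_clm_apply hd (differentiableAt_const _)]
  simp

lemma hess_isSymm (hf : ContDiff ℝ 2 f) (x : EuclideanSpace ℝ (Fin n)) :
    (hess n f x).IsSymm := by
  ext i j
  rw [transpose_apply, hess_apply hf, hess_apply hf]
  exact hf.contDiffAt.isSymmSndFDerivAt (by simp) _ _

lemma eq_sum_single (v : EuclideanSpace ℝ (Fin n)) :
    v = ∑ i, v i • EuclideanSpace.single i (1 : ℝ) := by
  simpa using ((EuclideanSpace.basisFun (Fin n) ℝ).sum_repr v).symm

lemma fderiv_apply_eq_dotProduct (x v : EuclideanSpace ℝ (Fin n)) :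
    fderiv ℝ f x v = grad n f x ⬝ᵥ v.ofLp := by
  conv_lhs => rw [eq_sum_single v]
  simp [grad, dotProduct, mul_comm]

lemma dotProduct_hess_mulVec (hf : ContDiff ℝ 2 f) (x v : EuclideanSpace ℝ (Fin n)) :
    v.ofLp ⬝ᵥ (hess n f x *ᵥ v.ofLp) = fderiv ℝ (fderiv ℝ f) x v v := by
  conv_rhs => rw [eq_sum_single v]
  simp only [map_sum, map_smul, _root_.sum_apply, _root_.smul_apply,
    dotProduct, mulVec, hess_apply hf, smul_eq_mul, Finset.mul_sum]
  rw [Finset.sum_comm]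
  refine Finset.sum_congr rfl fun i _ => Finset.sum_congr rfl fun j _ => ?_
  ring

lemma scalarCurv_le_meanCurv_sq (hn : 2 ≤ n) (hf : ContDiff ℝ 2 f)
    (x : EuclideanSpace ℝ (Fin n)) : scalarCurv n f x ≤ meanCurv n f x ^ 2 := by
  have h := (invMetric_posSemidef (grad n f x)).sq_trace_mul_le
    ((hess_isSymm hf x).smul (Real.sqrt (1 + gradSq n f x))⁻¹)
  rw [← shapeOp_eq, Fintype.card_fin] at h
  have hn' : (2 : ℝ) ≤ n := by exact_mod_cast hn
  have h1 : (0 : ℝ) < n - 1 := by linarith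
  rw [scalarCurv, meanCurv, div_pow, div_le_div_iff₀ (by positivity) (by positivity)]
  nlinarith [mul_le_mul_of_nonneg_left h (show (0 : ℝ) ≤ n by positivity)]

/-- If all principal curvatures are at most `κ`, then `H ≤ κ` and `R ≥ 2κH - κ²`. -/
lemma curvature_bounds_of_posSemidef (hn : 2 ≤ n) {κ : ℝ} {x : EuclideanSpace ℝ (Fin n)}
    (hE : (κ • (1 + vecMulVec (grad n f x) (grad n f x)) -
      (Real.sqrt (1 + gradSq n f x))⁻¹ • hess n f x).PosSemidef) :
    meanCurv n f x ≤ κ ∧ 2 * κ * meanCurv n f x - κ ^ 2 ≤ scalarCurv n f x := by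
  obtain ⟨h₁, h₂⟩ :=
    (invMetric_posSemidef (grad n f x)).trace_mul_nonneg_and_trace_sq_le hE
  rw [mul_sub, mul_smul_comm, invMetric_mul_metric, ← shapeOp_eq] at h₁ h₂
  have hn' : (2 : ℝ) ≤ n := by exact_mod_cast hn
  have hn1 : (0 : ℝ) < n - 1 := by linarith
  simp only [sub_mul, mul_sub, smul_mul_assoc, mul_smul_comm, one_mul, mul_one, trace_sub,
    trace_smul, trace_one, Fintype.card_fin, smul_eq_mul] at h₁ h₂
  rw [scalarCurv, meanCurv, le_div_iff₀ (by positivity), div_le_iff₀ (by positivity)]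
  refine ⟨by linarith, ?_⟩
  rw [show (2 * κ * ((shapeOp n f x).trace / n) - κ ^ 2) * (n * (n - 1)) =
    2 * κ * (shapeOp n f x).trace * (n - 1) - κ ^ 2 * n * (n - 1) by field_simp]
  linarith

end ShapeOperator

section Touching

open Filter Topology
open scoped Matrix RealInnerProductSpace

/-- Second-order necessary condition for a local maximum of a function of one variable. -/
lemma IsLocalMax.deriv_deriv_nonpos {φ : ℝ → ℝ} {a : ℝ} (h : IsLocalMax φ a)
    (hc : ContinuousAt φ a) : deriv (deriv φ) a ≤ 0 := by
  by_contra! hpos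
  have hmin := isLocalMin_of_deriv_deriv_pos hpos h.deriv_eq_zero hc
  have hconst : φ =ᶠ[𝓝 a] fun _ => φ a := by
    filter_upwards [h, hmin] with t h₁ h₂ using le_antisymm h₁ h₂
  have := hconst.deriv.deriv_eq
  simp at this
  linarith

/-- The height of the upper hemisphere of radius `r` above `x`. -/
noncomputable def hemisphere {E : Type*} [NormedAddCommGroup E] (r : ℝ) (x : E) : ℝ :=
  Real.sqrt (r ^ 2 - ‖x‖ ^ 2)

section General

variable {E : Type*} [NormedAddCommGroup E] [InnerProductSpace ℝ E]

/-- Adding a hemisphere, which has infinite slope at the boundary, moves the maximum of a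
differentiable function on a closed ball to the interior. -/
lemma exists_mem_ball_isMaxOn_add_hemisphere [ProperSpace E] {f : E → ℝ}
    (hf : Differentiable ℝ f) {r : ℝ} (hr : 0 < r) :
    ∃ x ∈ ball (0 : E) r, IsMaxOn (fun y => f y + hemisphere r y) (closedBall 0 r) x := by
  have hcont : Continuous fun y => f y + hemisphere r y :=
    hf.continuous.add (by unfold hemisphere; fun_prop)
  obtain ⟨x, hx, hmax⟩ := (isCompact_closedBall (0 : E) r).exists_isMaxOn
    ⟨0, by simp [hr.le]⟩ hcont.continuousOn
  refine ⟨x, ?_, hmax⟩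
  rw [mem_closedBall_zero_iff] at hx
  rw [mem_ball_zero_iff]
  refine lt_of_le_of_ne hx fun hxr => ?_
  have hd : HasDerivAt (fun t : ℝ => f (x - t • x)) (-(fderiv ℝ f x x)) 0 := by
    have h1 : HasDerivAt (fun t : ℝ => x - t • x) (-x) 0 := by
      simpa using ((hasDerivAt_id (0 : ℝ)).smul_const x).const_sub x
    have h2 : HasFDerivAt f (fderiv ℝ f x) (x - (0 : ℝ) • x) := by
      simpa using (hf x).hasFDerivAt
    simpa [Function.comp_def] using h2.comp_hasDerivAt (0 : ℝ) h1
  obtain ⟨K, hK0, hK⟩ := hd.isBigO_sub.exists_pos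
  rw [Asymptotics.isBigOWith_iff] at hK
  have hsmall : ∀ᶠ t : ℝ in 𝓝 0, t * (K ^ 2 + r ^ 2) < r ^ 2 :=
    (continuous_id.mul continuous_const).continuousAt.eventually_lt
      continuousAt_const (by simp; positivity)
  have hsmall' : ∀ᶠ t : ℝ in 𝓝 0, t < 1 := eventually_lt_nhds one_pos
  have hev := (hK.and (hsmall.and hsmall')).filter_mono (nhdsWithin_le_nhds (s := Set.Ioi 0))
  obtain ⟨t, ⟨h1, h2, h3⟩, h4⟩ := (hev.and self_mem_nhdsWithin).exists
  replace h4 : 0 < t := h4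
  have hnorm : ‖x - t • x‖ = (1 - t) * r := by
    rw [show x - t • x = (1 - t) • x by module, norm_smul, hxr, Real.norm_of_nonneg (by linarith)]
  have hle : f (x - t • x) + hemisphere r (x - t • x) ≤ f x + hemisphere r x := by
    refine hmax ?_
    rw [mem_closedBall_zero_iff, hnorm]
    nlinarith
  simp only [zero_smul, sub_zero, Real.norm_eq_abs, abs_of_pos h4] at h1
  simp only [hemisphere, hnorm, hxr, sub_self, Real.sqrt_zero] at hle
  have h5 : Real.sqrt (r ^ 2 - ((1 - t) * r) ^ 2) ≤ K * t := by
    linarith [(abs_le.1 h1).1]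
  rw [Real.sqrt_le_left (by positivity)] at h5
  have : t * (r ^ 2 * (2 - t)) ≤ t * (K ^ 2 * t) := by linarith
  have := le_of_mul_le_mul_left this h4
  nlinarith

lemma hasDerivAt_line (x v : E) (t : ℝ) : HasDerivAt (fun s : ℝ => x + s • v) v t := by
  simpa using ((hasDerivAt_id t).smul_const v).const_add x

/-- First- and second-order conditions at a maximum of `f + hemisphere r`. -/
lemma fderiv_eq_and_fderiv_fderiv_le_of_isMaxOn_add_hemisphere {f : E → ℝ}
    (hf : ContDiff ℝ 2 f) {r : ℝ} {x : E} (hx : x ∈ ball (0 : E) r)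
    (hmax : IsMaxOn (fun y => f y + hemisphere r y) (closedBall 0 r) x) (v : E) :
    fderiv ℝ f x v = ⟪x, v⟫ / hemisphere r x ∧
      fderiv ℝ (fderiv ℝ f) x v v ≤
        ‖v‖ ^ 2 / hemisphere r x + ⟪x, v⟫ ^ 2 / hemisphere r x ^ 3 := by
  have hline := hasDerivAt_line x v
  set q : ℝ → ℝ := fun t => r ^ 2 - ‖x + t • v‖ ^ 2 with hq
  have hq' : ∀ t, HasDerivAt q (-(2 * ⟪x + t • v, v⟫)) t := fun t => by
    simpa using ((hline t).norm_sq).const_sub (r ^ 2)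
  have hq0 : 0 < q 0 := by
    have hx' : ‖x‖ < r := by simpa using hx
    have := norm_nonneg x
    simp only [hq, zero_smul, add_zero]
    nlinarith
  have hqpos : ∀ᶠ t in 𝓝 (0 : ℝ), 0 < q t := (hq' 0).continuousAt.eventually_const_lt hq0
  have hw : Real.sqrt (q 0) = hemisphere r x := by simp [hq, hemisphere]
  have hwpos : 0 < hemisphere r x := hw ▸ Real.sqrt_pos.2 hq0
  set φ : ℝ → ℝ := fun t => f (x + t • v) + Real.sqrt (q t) with hφ
  have hsqrt : ∀ t, 0 < q t →
      HasDerivAt (fun t => Real.sqrt (q t)) (-(⟪x + t • v, v⟫) / Real.sqrt (q t)) t := by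
    intro t ht
    convert (hq' t).sqrt ht.ne' using 1
    ring
  have hφ' : ∀ t, 0 < q t →
      HasDerivAt φ (fderiv ℝ f (x + t • v) v + -(⟪x + t • v, v⟫) / Real.sqrt (q t)) t := by
    intro t ht
    exact ((hf.differentiable (by norm_num) _).hasFDerivAt.comp_hasDerivAt t (hline t)).add
      (hsqrt t ht)
  have hloc : IsLocalMax φ 0 := by
    filter_upwards [hqpos] with t ht
    have hmem : x + t • v ∈ closedBall (0 : E) r := by
      rw [mem_closedBall_zero_iff]
      have hr : 0 < r := pos_of_mem_ball hx
      refine abs_le_of_sq_le_sq' ?_ hr.le |>.2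
      simp only [hq] at ht
      linarith
    simpa [hφ, hq, hemisphere] using hmax hmem
  have hder : deriv φ =ᶠ[𝓝 0]
      fun t => fderiv ℝ f (x + t • v) v + -(⟪x + t • v, v⟫) / Real.sqrt (q t) := by
    filter_upwards [hqpos] with t ht using (hφ' t ht).deriv
  have h1 := hloc.deriv_eq_zero
  have h2 := hloc.deriv_deriv_nonpos (hφ' 0 hq0).continuousAt
  have hD : HasDerivAt (fun t : ℝ => fderiv ℝ f (x + t • v) v)
      (fderiv ℝ (fderiv ℝ f) x v v) 0 := by
    have hd : HasFDerivAt (fderiv ℝ f) (fderiv ℝ (fderiv ℝ f) x) (x + (0 : ℝ) • v) := by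
      simpa using (((hf.fderiv_right (m := 1) (by norm_num)).differentiable
        (by norm_num)) x).hasFDerivAt
    have hcomp : HasDerivAt (fun t : ℝ => fderiv ℝ f (x + t • v))
        (fderiv ℝ (fderiv ℝ f) x v) 0 := hd.comp_hasDerivAt (0 : ℝ) (hline 0)
    simpa using hcomp.clm_apply (hasDerivAt_const (0 : ℝ) v)
  have hin : HasDerivAt (fun t : ℝ => -(⟪x + t • v, v⟫)) (-(‖v‖ ^ 2)) 0 := by
    simpa using ((hline 0).inner ℝ (hasDerivAt_const (0 : ℝ) v)).fun_neg
  have hquot := hin.fun_div (hsqrt 0 hq0) (by rw [hw]; exact hwpos.ne')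
  rw [(hφ' 0 hq0).deriv, hw] at h1
  rw [hder.deriv_eq, (hD.fun_add hquot).deriv, hw] at h2
  simp only [zero_smul, add_zero] at h1 h2
  refine ⟨by linear_combination h1, ?_⟩
  have heq : (-‖v‖ ^ 2 * hemisphere r x - -⟪x, v⟫ * (-⟪x, v⟫ / hemisphere r x)) /
      hemisphere r x ^ 2 = -(‖v‖ ^ 2 / hemisphere r x + ⟪x, v⟫ ^ 2 / hemisphere r x ^ 3) := by
    field_simp
    ring
  linarith

end General

variable {n : ℕ} {f : EuclideanSpace ℝ (Fin n) → ℝ}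

/-- Some point of the graph has all principal curvatures at most `1 / r`. -/
lemma exists_posSemidef (hf : ContDiff ℝ 2 f) {r : ℝ} (hr : 0 < r) :
    ∃ x ∈ closedBall (0 : EuclideanSpace ℝ (Fin n)) r,
      ((1 / r) • (1 + Matrix.vecMulVec (grad n f x) (grad n f x)) -
        (Real.sqrt (1 + gradSq n f x))⁻¹ • hess n f x).PosSemidef := by
  obtain ⟨x, hx, hmax⟩ :=
    exists_mem_ball_isMaxOn_add_hemisphere (hf.differentiable (by norm_num)) hr
  refine ⟨x, ball_subset_closedBall hx, posSemidef_of_isSymm ?_ fun u => ?_⟩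
  · exact ((Matrix.isSymm_one.add (vecMulVec_self_isSymm _)).smul _).sub
      ((hess_isSymm hf x).smul _)
  have hcond := fderiv_eq_and_fderiv_fderiv_le_of_isMaxOn_add_hemisphere hf hx hmax
  have hx' : ‖x‖ < r := by simpa using hx
  have hpos : 0 < r ^ 2 - ‖x‖ ^ 2 := by
    have := norm_nonneg x
    nlinarith
  set w := hemisphere r x with hw
  have hwpos : 0 < w := Real.sqrt_pos.2 hpos
  have hw2 : w ^ 2 = r ^ 2 - ‖x‖ ^ 2 := Real.sq_sqrt hpos.le
  have hgrad : ∀ i, grad n f x i = x i / w := fun i => by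
    rw [grad, (hcond _).1]
    simp [EuclideanSpace.inner_single_right]
  have hsq : 1 + gradSq n f x = (r / w) ^ 2 := by
    simp only [gradSq, hgrad, div_pow, ← Finset.sum_div, ← EuclideanSpace.real_norm_sq_eq]
    field_simp
    linarith
  have hc : (Real.sqrt (1 + gradSq n f x))⁻¹ = w / r := by
    rw [hsq, Real.sqrt_sq (by positivity), inv_div]
  obtain ⟨h1, h2⟩ := hcond (WithLp.toLp 2 u)
  rw [fderiv_apply_eq_dotProduct] at h1
  rw [← dotProduct_hess_mulVec hf, EuclideanSpace.real_norm_sq_eq] at h2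
  simp only at h1 h2
  have hu : u ⬝ᵥ u = ∑ i, u i ^ 2 := by simp [dotProduct, sq]
  rw [hc, Matrix.sub_mulVec, Matrix.smul_mulVec, Matrix.smul_mulVec, Matrix.add_mulVec,
    Matrix.one_mulVec, dotProduct_sub, dotProduct_smul, dotProduct_smul, dotProduct_add,
    dotProduct_vecMulVec_mulVec, h1, hu, smul_eq_mul, smul_eq_mul, sub_nonneg]
  refine (mul_le_mul_of_nonneg_left h2 (by positivity)).trans_eq ?_
  field_simp

end Touching

section Negation

variable {n : ℕ} {f : EuclideanSpace ℝ (Fin n) → ℝ}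

lemma shapeOp_neg (x : EuclideanSpace ℝ (Fin n)) : shapeOp n (-f) x = -shapeOp n f x := by
  have hg : ∀ i, grad n (-f) x i = -grad n f x i := fun i => by simp [grad, fderiv_neg]
  have hh : hess n (-f) x = -hess n f x := by
    ext i j
    simp [hess, fderiv_neg]
  have hs : gradSq n (-f) x = gradSq n f x := by simp [gradSq, hg]
  simp [shapeOp, hg, hh, hs]

lemma meanCurv_neg (x : EuclideanSpace ℝ (Fin n)) : meanCurv n (-f) x = -meanCurv n f x := by
  simp [meanCurv, shapeOp_neg, neg_div]

end Negation

section Continuity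

variable {n : ℕ} {f : EuclideanSpace ℝ (Fin n) → ℝ}

lemma continuous_shapeOp (hf : ContDiff ℝ 2 f) : Continuous (shapeOp n f) := by
  have hg : ∀ i, Continuous fun x => grad n f x i := fun i =>
    (hf.continuous_fderiv (by norm_num)).clm_apply continuous_const
  have hh : Continuous (hess n f) := by
    refine continuous_matrix fun i j => ?_
    simp only [hess_apply hf]
    exact ((((hf.fderiv_right (m := 1) (by norm_num)).continuous_fderiv (by norm_num)).clm_apply
      continuous_const).clm_apply continuous_const)
  have hs : Continuous (gradSq n f) := by
    unfold gradSq
    fun_prop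
  have hpos : ∀ x, 0 < 1 + gradSq n f x := fun x => by
    have : 0 ≤ gradSq n f x := Finset.sum_nonneg fun i _ => sq_nonneg _
    linarith
  have hP : Continuous fun x => invMetric (grad n f x) := by
    refine continuous_const.sub (continuous_matrix fun i j => ?_)
    exact ((hg i).mul (hg j)).div (continuous_const.add hs) fun x => (hpos x).ne'
  have hc : Continuous fun x => (Real.sqrt (1 + gradSq n f x))⁻¹ :=
    (Real.continuous_sqrt.comp (continuous_const.add hs)).inv₀
      fun x => (Real.sqrt_pos.2 (hpos x)).ne'
  simp only [funext shapeOp_eq]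
  exact hP.matrix_mul (hc.smul hh)

lemma continuous_meanCurv (hf : ContDiff ℝ 2 f) : Continuous (meanCurv n f) :=
  (continuous_shapeOp hf).matrix_trace.div_const _

lemma continuous_scalarCurv (hf : ContDiff ℝ 2 f) : Continuous (scalarCurv n f) :=
  have h := continuous_shapeOp hf
  ((h.matrix_trace.pow 2).sub (h.matrix_mul h).matrix_trace).div_const _

end Continuity

lemma exists_meanCurv_le_and_le_scalarCurv {n : ℕ} (hn : 2 ≤ n) {r : ℝ} (hr : 0 < r)
    {f : EuclideanSpace ℝ (Fin n) → ℝ} (hf : ContDiff ℝ 2 f) :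
    ∃ x ∈ closedBall (0 : EuclideanSpace ℝ (Fin n)) r, meanCurv n f x ≤ 1 / r ∧
      2 * (1 / r) * meanCurv n f x - (1 / r) ^ 2 ≤ scalarCurv n f x := by
  obtain ⟨x, hx, hE⟩ := exists_posSemidef hf hr
  exact ⟨x, hx, curvature_bounds_of_posSemidef hn hE⟩

/-- If `R ≤ 0` where a lower hemisphere touches the graph, the estimate holds there. Otherwise
`R` vanishes somewhere, or `R > 0` and `H` has a constant sign because `H ^ 2 ≥ R`, so that the estimate
holds where a hemisphere on the appropriate side touches the graph. -/
lemma exists_abs_scalarCurv_le {n : ℕ} (hn : 2 ≤ n) {r : ℝ} (hr : 0 < r)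
    {f : EuclideanSpace ℝ (Fin n) → ℝ} (hf : ContDiff ℝ 2 f) {K : ℝ}
    (hK : ∀ x ∈ closedBall (0 : EuclideanSpace ℝ (Fin n)) r, |meanCurv n f x| ≤ K) :
    ∃ x ∈ closedBall (0 : EuclideanSpace ℝ (Fin n)) r,
      |scalarCurv n f x| ≤ (K + 1 / r) * (2 / r) := by
  set s := closedBall (0 : EuclideanSpace ℝ (Fin n)) r
  have hs : IsPreconnected s := (convex_closedBall _ _).isPreconnected
  have hκ : 0 < 1 / r := by positivity
  have hK0 : 0 ≤ K := (abs_nonneg _).trans (hK 0 (by simp [s, hr.le]))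
  rw [show (K + 1 / r) * (2 / r) = 2 * (1 / r) * K + 2 * (1 / r) ^ 2 by ring]
  obtain ⟨x, hx, hHx, hRx⟩ := exists_meanCurv_le_and_le_scalarCurv hn hr hf
  obtain ⟨y, hy, hHy, -⟩ := exists_meanCurv_le_and_le_scalarCurv hn hr (f := -f) hf.neg
  rw [meanCurv_neg] at hHy
  by_cases hx0 : scalarCurv n f x ≤ 0
  · refine ⟨x, hx, ?_⟩
    have := (abs_le.1 (hK x hx)).1
    rw [abs_of_nonpos hx0]
    nlinarith
  by_cases hzero : ∃ z ∈ s, scalarCurv n f z = 0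
  · obtain ⟨z, hz, hRz⟩ := hzero
    exact ⟨z, hz, by rw [hRz, abs_zero]; positivity⟩
  push Not at hx0 hzero
  have hpos : ∀ z ∈ s, 0 < scalarCurv n f z := by
    intro z hz
    by_contra! hle
    obtain ⟨p, hp, hp0⟩ := hs.intermediate_value hz hx (continuous_scalarCurv hf).continuousOn
      ⟨hle, hx0.le⟩
    exact hzero p hp hp0
  have hH : ∀ z ∈ s, meanCurv n f z ≠ 0 := fun z hz h0 => by
    have := (hpos z hz).trans_le (scalarCurv_le_meanCurv_sq hn hf z)
    simp [h0] at this
  suffices h : ∃ z ∈ s, |meanCurv n f z| ≤ 1 / r by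
    obtain ⟨z, hz, hHz⟩ := h
    refine ⟨z, hz, ?_⟩
    rw [abs_of_pos (hpos z hz)]
    have h2 := sq_le_sq' (by linarith [neg_abs_le (meanCurv n f z), abs_nonneg (meanCurv n f z)])
      hHz
    rw [sq_abs] at h2
    have := scalarCurv_le_meanCurv_sq hn hf z
    have : 0 ≤ 2 * (1 / r) * K := by positivity
    nlinarith
  rcases le_or_gt 0 (meanCurv n f x) with hx1 | hx1
  · exact ⟨x, hx, by rwa [abs_of_nonneg hx1]⟩
  rcases le_or_gt (meanCurv n f y) 0 with hy1 | hy1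
  · exact ⟨y, hy, by rwa [abs_of_nonpos hy1]⟩
  obtain ⟨p, hp, hp0⟩ := hs.intermediate_value hx hy (continuous_meanCurv hf).continuousOn
    ⟨hx1.le, hy1.le⟩
  exact absurd hp0 (hH p hp)

/-- **Theorem 2, first part.** For a graph over the closed ball of radius `r` in `ℝⁿ`,
`inf |R| ≤ (sup |H| + 1/r) · (2/r)`. -/
theorem inf_scalarCurv_le_of_graph_closedBall
    (n : ℕ) (hn : 2 ≤ n) (r : ℝ) (hr : 0 < r)
    (f : EuclideanSpace ℝ (Fin n) → ℝ) (hf : ContDiff ℝ 2 f) :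
    sInf ((fun x => |scalarCurv n f x|) '' closedBall (0 : EuclideanSpace ℝ (Fin n)) r)
      ≤ (sSup ((fun x => |meanCurv n f x|) '' closedBall (0 : EuclideanSpace ℝ (Fin n)) r)
          + 1 / r) * (2 / r) := by
  obtain ⟨x, hx, hle⟩ := exists_abs_scalarCurv_le hn hr hf fun y hy =>
    le_csSup ((isCompact_closedBall _ _).bddAbove_image
      (continuous_meanCurv hf).abs.continuousOn) (Set.mem_image_of_mem _ hy)
  refine (csInf_le ⟨0, ?_⟩ (Set.mem_image_of_mem _ hx)).trans hle
  rintro _ ⟨z, -, rfl⟩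
  exact abs_nonneg _
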